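/- arXiv:1212.5168 — 3 statements merged into one kernel-verified Lean document; each statement's English description precedes it below -/
import Mathlib

section
/- There exist positive semidefinite complex 2×2 matrices x and y for which no complex 2×2 matrix z satisfies ⟨zξ,ξ⟩ = max{⟨xξ,ξ⟩, ⟨yξ,ξ⟩} for all ξ ∈ ℂ². Here ⟨zξ,ξ⟩ denotes the standard inner product star(ξ) ⬝ᵥ (z *ᵥ ξ), and the required equality says that this complex number equals the (real) maximum of ⟨xξ,ξ⟩ and ⟨yξ,ξ⟩ (which are real since x and y are positive semidefinite). -/
open ComplexOrder Matrix

/-- There exist positive semidefinite complex 2×2 matrices `x` and `y` such that no complex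
2×2 matrix `z` satisfies `⟨zξ,ξ⟩ = max {⟨xξ,ξ⟩, ⟨yξ,ξ⟩}` for all `ξ ∈ ℂ²`. -/
theorem no_matrix_max_of_posSemidef :
    ∃ x y : Matrix (Fin 2) (Fin 2) ℂ, x.PosSemidef ∧ y.PosSemidef ∧
      ¬ ∃ z : Matrix (Fin 2) (Fin 2) ℂ, ∀ ξ : Fin 2 → ℂ,
        star ξ ⬝ᵥ (z *ᵥ ξ) =
          ((max (star ξ ⬝ᵥ (x *ᵥ ξ)).re (star ξ ⬝ᵥ (y *ᵥ ξ)).re : ℝ) : ℂ) := by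
  refine ⟨diagonal ![1, 0], diagonal ![0, 1], ?_, ?_, ?_⟩
  · exact PosSemidef.diagonal fun i => by fin_cases i <;> simp
  · exact PosSemidef.diagonal fun i => by fin_cases i <;> simp
  · rintro ⟨z, hz⟩
    -- The right-hand side violates the parallelogram law for `e₁`, `e₂`.
    have h₁ := hz ![1, 0]
    have h₂ := hz ![0, 1]
    have h_add := hz ![1, 1]
    have h_sub := hz ![1, -1]
    simp [dotProduct, mulVec, Fin.sum_univ_two, diagonal] at h₁ h₂ h_add h_sub
    have h_false : (4 : ℂ) = 2 := by
      linear_combination h_add + h_sub - 2 * h₁ - 2 * h₂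
    norm_num at h_false
end

section
/- Let H be a complex Hilbert space, let T be a positive bounded operator on H, and let e and f be projections on H. Then the operator norm satisfies ‖e T f‖ ≤ ‖e T e‖^{1/2} · ‖f T f‖^{1/2}, where the products denote composition of bounded operators. -/
open ContinuousLinearMap

/-- The Cauchy–Schwarz inequality for the sesquilinear map `(x, y) ↦ x⋆ a y` given by a nonnegative
element `a` of a C⋆-algebra. -/
lemma norm_star_mul_mul_le_sqrt_mul_sqrt {A : Type*} [CStarAlgebra A] [PartialOrder A]
    [StarOrderedRing A] {a : A} (ha : 0 ≤ a) (x y : A) :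
    ‖star x * a * y‖ ≤ Real.sqrt ‖star x * a * x‖ * Real.sqrt ‖star y * a * y‖ := by
  set r := CFC.sqrt a
  have hr : star r = r := (CFC.sqrt_nonneg a).isSelfAdjoint
  have hfactor (u v : A) : star u * a * v = star (r * u) * (r * v) := by
    rw [star_mul, hr, ← CFC.sqrt_mul_sqrt_self a ha]
    simp only [mul_assoc, r]
  have hsqrt (u : A) : Real.sqrt ‖star u * a * u‖ = ‖r * u‖ := by
    rw [hfactor, CStarRing.norm_star_mul_self, Real.sqrt_mul_self (norm_nonneg _)]
  rw [hsqrt, hsqrt, hfactor, ← norm_star (r * x)]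
  exact norm_mul_le _ _

/-- If `T` is a positive bounded operator on a complex Hilbert space `H` and `e`, `f` are
projections, then `‖eTf‖ ≤ ‖eTe‖^{1/2} ‖fTf‖^{1/2}`. -/
theorem norm_corner_le_sqrt_mul_sqrt {H : Type*} [NormedAddCommGroup H]
    [InnerProductSpace ℂ H] [CompleteSpace H] (T e f : H →L[ℂ] H)
    (hT : T.IsPositive) (he_sa : IsSelfAdjoint e) (he_idem : e ∘L e = e)
    (hf_sa : IsSelfAdjoint f) (hf_idem : f ∘L f = f) :
    ‖e ∘L T ∘L f‖ ≤ Real.sqrt ‖e ∘L T ∘L e‖ * Real.sqrt ‖f ∘L T ∘L f‖ := by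
  have h := norm_star_mul_mul_le_sqrt_mul_sqrt ((nonneg_iff_isPositive T).mpr hT) e f
  rwa [he_sa.star_eq, hf_sa.star_eq] at h
end

section
/- Let (Ω, ν) be a measure space and let g : Ω → [0,∞) be measurable with ν({g > v}) < ∞ for every v > 0. Define the dyadic discretization ĝ(ω) = Σ'_{j ∈ ℤ} 2^{j+1} · χ_{(2^j, 2^{j+1}]}(g(ω)) (so ĝ(ω) = 2^{j+1} when 2^j < g(ω) ≤ 2^{j+1}, and ĝ(ω) = 0 when g(ω) = 0). Then g ≤ ĝ ≤ 2g pointwise, and for every t ≥ 0 the decreasing rearrangement of ĝ satisfies μ_t(ĝ) = Σ'_{k ∈ ℤ} 2^k · χ_{[0, ν({g > 2^k}))}(t), i.e. μ_t(ĝ) equals the sum of 2^k over all integers k with t < ν({g > 2^k}). -/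
open MeasureTheory Set
open scoped ENNReal

/-- The decreasing rearrangement `μ_t(h) = inf { v > 0 : ν({h > v}) ≤ t }` of a measurable
function `h : Ω → [0,∞]`, with the convention `inf ∅ = ∞`. -/
noncomputable def decRearrangement {Ω : Type*} [MeasurableSpace Ω] (ν : Measure Ω)
    (h : Ω → ℝ≥0∞) (t : ℝ≥0∞) : ℝ≥0∞ :=
  sInf {v : ℝ≥0∞ | 0 < v ∧ ν {ω | v < h ω} ≤ t}

theorem tsum_dyadic_eq_of_mem {x : ℝ} {j : ℤ} (h₁ : (2 : ℝ) ^ j < x)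
    (h₂ : x ≤ (2 : ℝ) ^ (j + 1)) :
    (∑' i : ℤ, if (2 : ℝ) ^ i < x ∧ x ≤ (2 : ℝ) ^ (i + 1) then
      ENNReal.ofReal ((2 : ℝ) ^ (i + 1)) else 0) = ENNReal.ofReal ((2 : ℝ) ^ (j + 1)) := by
  rw [tsum_eq_single j, if_pos ⟨h₁, h₂⟩]
  rintro i hij
  refine if_neg fun ⟨h₃, h₄⟩ => hij ?_
  have h₅ := (zpow_lt_zpow_iff_right₀ (one_lt_two (α := ℝ))).1 (h₁.trans_le h₄)
  have h₆ := (zpow_lt_zpow_iff_right₀ (one_lt_two (α := ℝ))).1 (h₃.trans_le h₂)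
  omega

theorem tsum_dyadic_eq_zero {x : ℝ} (hx : x ≤ 0) :
    (∑' i : ℤ, if (2 : ℝ) ^ i < x ∧ x ≤ (2 : ℝ) ^ (i + 1) then
      ENNReal.ofReal ((2 : ℝ) ^ (i + 1)) else 0) = 0 := by
  refine ENNReal.tsum_eq_zero.2 fun i => if_neg fun h => ?_
  have : (0 : ℝ) < 2 ^ i := by positivity
  linarith [h.1]

theorem ofReal_two_zpow_lt_tsum_dyadic_iff (x : ℝ) (k : ℤ) :
    (ENNReal.ofReal ((2 : ℝ) ^ k) < ∑' i : ℤ,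
      if (2 : ℝ) ^ i < x ∧ x ≤ (2 : ℝ) ^ (i + 1) then
        ENNReal.ofReal ((2 : ℝ) ^ (i + 1)) else 0) ↔ (2 : ℝ) ^ k < x := by
  have hk : (0 : ℝ) < 2 ^ k := by positivity
  rcases le_or_gt x 0 with hx | hx
  · rw [tsum_dyadic_eq_zero hx]
    simp [hx.trans hk.le]
  · obtain ⟨j, h₁, h₂⟩ := exists_mem_Ioc_zpow hx (one_lt_two (α := ℝ))
    rw [tsum_dyadic_eq_of_mem h₁ h₂, ENNReal.ofReal_lt_ofReal_iff (by positivity),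
      zpow_lt_zpow_iff_right₀ one_lt_two]
    refine ⟨fun h => lt_of_le_of_lt ?_ h₁, fun h => ?_⟩
    · exact zpow_le_zpow_right₀ one_le_two (by omega)
    · exact (zpow_lt_zpow_iff_right₀ (one_lt_two (α := ℝ))).1 (h.trans_le h₂)

theorem tsum_two_zpow_le (K : ℤ) :
    (∑' k : ℤ, if k ≤ K then ENNReal.ofReal ((2 : ℝ) ^ k) else 0) =
      ENNReal.ofReal ((2 : ℝ) ^ (K + 1)) := by
  have hinj : Function.Injective fun n : ℕ => K - (n : ℤ) := fun a b h => by
    simp only at h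
    omega
  rw [← hinj.tsum_eq]
  · have h := hasSum_geometric_two' ((2 : ℝ) ^ (K + 1))
    rw [← h.tsum_eq, ENNReal.ofReal_tsum_of_nonneg (fun n => by positivity) h.summable]
    refine tsum_congr fun n => ?_
    rw [if_pos (by omega), zpow_sub₀ two_ne_zero, zpow_add_one₀ two_ne_zero]
    simp
  · intro k hk
    have hkK : k ≤ K := by
      by_contra h
      simp [h] at hk
    exact ⟨(K - k).toNat, by simp only; omega⟩

theorem exists_le_ofReal_two_zpow {v : ℝ≥0∞} (hv : v ≠ ∞) :
    ∃ k : ℤ, v ≤ ENNReal.ofReal ((2 : ℝ) ^ k) := by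
  obtain ⟨n, hn⟩ := pow_unbounded_of_one_lt v.toReal (one_lt_two (α := ℝ))
  exact ⟨n, (ENNReal.le_ofReal_iff_toReal_le hv (by positivity)).2 (by simpa using hn.le)⟩

theorem exists_ofReal_two_zpow_lt {v : ℝ≥0∞} (hv : 0 < v) :
    ∃ k : ℤ, ENNReal.ofReal ((2 : ℝ) ^ k) < v := by
  obtain ⟨r, -, hr, hrv⟩ := ENNReal.lt_iff_exists_real_btwn.1 hv
  obtain ⟨k, hk, -⟩ := exists_mem_Ioc_zpow (ENNReal.ofReal_pos.1 hr) (one_lt_two (α := ℝ))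
  exact ⟨k, (ENNReal.ofReal_le_ofReal hk.le).trans_lt hrv⟩

theorem tsum_ofReal_two_zpow : ∑' k : ℤ, ENNReal.ofReal ((2 : ℝ) ^ k) = ∞ := by
  by_contra h
  obtain ⟨k, hk⟩ := exists_le_ofReal_two_zpow h
  have h₁ := hk.trans_lt <| (ENNReal.ofReal_lt_ofReal_iff (by positivity)).2
    (zpow_lt_zpow_right₀ (one_lt_two (α := ℝ)) (lt_add_one k))
  exact (ENNReal.le_tsum (k + 1)).not_gt h₁

/-- For a measurable `g : Ω → [0,∞)` with `ν({g > v}) < ∞` for all `v > 0`, the dyadic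
discretization `ĝ = Σ'_j 2^{j+1} χ_{(2^j, 2^{j+1}]} ∘ g` satisfies `g ≤ ĝ ≤ 2g` pointwise
and `μ_t(ĝ) = Σ'_k 2^k χ_{[0, ν({g > 2^k}))}(t)`. -/
theorem decRearrangement_dyadic {Ω : Type*} [MeasurableSpace Ω] (ν : Measure Ω)
    (g : Ω → ℝ) (hg : Measurable g) (hg0 : ∀ ω, 0 ≤ g ω)
    (hfin : ∀ v : ℝ, 0 < v → ν {ω | v < g ω} < ∞)
    (ghat : Ω → ℝ≥0∞)
    (hghat : ghat = fun ω => ∑' j : ℤ,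
      if (2 : ℝ) ^ j < g ω ∧ g ω ≤ (2 : ℝ) ^ (j + 1) then
        ENNReal.ofReal ((2 : ℝ) ^ (j + 1)) else 0) :
    (∀ ω, ENNReal.ofReal (g ω) ≤ ghat ω ∧ ghat ω ≤ ENNReal.ofReal (2 * g ω)) ∧
    ∀ t : ℝ≥0∞,
      decRearrangement ν ghat t =
        ∑' k : ℤ, if t < ν {ω | (2 : ℝ) ^ k < g ω} then ENNReal.ofReal ((2 : ℝ) ^ k)
          else 0 := by
  have hlt : ∀ k : ℤ, {ω | ENNReal.ofReal ((2 : ℝ) ^ k) < ghat ω} = {ω | (2 : ℝ) ^ k < g ω} := by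
    intro k
    ext ω
    simp only [hghat, mem_ofPred_eq]
    exact ofReal_two_zpow_lt_tsum_dyadic_iff (g ω) k
  have hanti : ∀ {j k : ℤ}, j ≤ k → ν {ω | (2 : ℝ) ^ k < g ω} ≤ ν {ω | (2 : ℝ) ^ j < g ω} :=
    fun hjk => measure_mono fun _ hω =>
      lt_of_le_of_lt (b := (2 : ℝ) ^ _) (zpow_le_zpow_right₀ one_le_two hjk) hω
  refine ⟨fun ω => ?_, fun t => ?_⟩
  · rcases (hg0 ω).eq_or_lt with hω | hω
    · rw [hghat]
      simp only [tsum_dyadic_eq_zero hω.ge]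
      simp [← hω]
    · obtain ⟨j, h₁, h₂⟩ := exists_mem_Ioc_zpow hω (one_lt_two (α := ℝ))
      rw [hghat]
      simp only [tsum_dyadic_eq_of_mem h₁ h₂]
      refine ⟨ENNReal.ofReal_le_ofReal h₂, ENNReal.ofReal_le_ofReal ?_⟩
      rw [zpow_add_one₀ two_ne_zero]
      linarith
  -- If `t < ν {2 ^ k < g}`, then every admissible level is at least `2 ^ (k + 1)`.
  have hlower : ∀ k : ℤ, t < ν {ω | (2 : ℝ) ^ k < g ω} →
      ENNReal.ofReal ((2 : ℝ) ^ (k + 1)) ≤ decRearrangement ν ghat t := by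
    refine fun k hk => le_sInf fun v hv => ?_
    by_contra! hvk
    refine (hk.trans_le (measure_mono fun ω hω => ?_)).not_ge hv.2
    obtain ⟨j, h₁, h₂⟩ := exists_mem_Ioc_zpow ((by positivity : (0 : ℝ) < 2 ^ k).trans hω)
      (one_lt_two (α := ℝ))
    have hkj : k < j + 1 :=
      (zpow_lt_zpow_iff_right₀ (one_lt_two (α := ℝ))).1 (lt_of_lt_of_le hω h₂)
    simp only [hghat, mem_ofPred_eq, tsum_dyadic_eq_of_mem h₁ h₂]
    exact hvk.trans_le (ENNReal.ofReal_le_ofReal (zpow_le_zpow_right₀ one_le_two (by omega)))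
  have hupper : ∀ k : ℤ, ν {ω | (2 : ℝ) ^ k < g ω} ≤ t →
      decRearrangement ν ghat t ≤ ENNReal.ofReal ((2 : ℝ) ^ k) := fun k hk =>
    sInf_le ⟨ENNReal.ofReal_pos.2 (by positivity), (hlt k).symm ▸ hk⟩
  by_cases hall : ∀ k : ℤ, t < ν {ω | (2 : ℝ) ^ k < g ω}
  · simp only [hall, if_true, tsum_ofReal_two_zpow]
    by_contra h
    obtain ⟨k, hk⟩ := exists_le_ofReal_two_zpow h
    have h₁ := hk.trans_lt <| (ENNReal.ofReal_lt_ofReal_iff (by positivity)).2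
      (zpow_lt_zpow_right₀ (one_lt_two (α := ℝ)) (lt_add_one k))
    exact (hlower k (hall k)).not_gt h₁
  obtain ⟨b, hb⟩ := not_forall.1 hall
  by_cases hex : ∃ k : ℤ, t < ν {ω | (2 : ℝ) ^ k < g ω}
  · obtain ⟨K, hK, hmax⟩ := Int.exists_greatest_of_bdd
      (P := fun k : ℤ => t < ν {ω | (2 : ℝ) ^ k < g ω})
      ⟨b, fun k hk => le_of_not_ge fun hbk => hb (hk.trans_le (hanti hbk))⟩ hex
    have hiff : ∀ k : ℤ, t < ν {ω | (2 : ℝ) ^ k < g ω} ↔ k ≤ K :=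
      fun k => ⟨hmax k, fun hk => hK.trans_le (hanti hk)⟩
    simp only [hiff, tsum_two_zpow_le]
    refine le_antisymm (hupper _ (not_lt.1 fun h => ?_)) (hlower K hK)
    have := hmax _ h
    omega
  · have hle : ∀ k : ℤ, ¬ t < ν {ω | (2 : ℝ) ^ k < g ω} := not_exists.1 hex
    simp only [hle, if_false, tsum_zero]
    by_contra h
    obtain ⟨k, hk⟩ := exists_ofReal_two_zpow_lt (pos_iff_ne_zero.2 h)
    exact (hupper k (not_lt.1 (hle k))).not_gt hk
end
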